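/- arXiv:2407.15210 — 8 statements merged into one kernel-verified Lean document; each statement's English description precedes it below -/
import Mathlib

section
/- For every real number a > 0, the set of sign sequences ε for which the sequence (u_{n,ε})_n has no limit in the extended real line EReal is at most countable. Consequently, there exists at least one representable element of EReal. -/
open Filter Topology

/-- Exponential on the extended real line, with e^{-∞}=0 and e^{+∞}=+∞. -/
noncomputable def eexp (y : EReal) : EReal :=
  if y = ⊥ then (0 : EReal) else if y = ⊤ then ⊤ else ((Real.exp y.toReal : ℝ) : EReal)

/-- `fSgn a s` is `f₊ : x ↦ e^{a·x}` when `s = true` and `f₋ : x ↦ -e^{a·x}` when `s = false`. -/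
noncomputable def fSgn (a : ℝ) (s : Bool) (x : EReal) : EReal :=
  if s then eexp ((a : EReal) * x) else -eexp ((a : EReal) * x)

/-- `uSeq a n ε = f_{ε₁}(f_{ε₂}(⋯ f_{ε_n}(1)⋯))`, where `ε (k-1)` is the k-th sign. -/
noncomputable def uSeq (a : ℝ) : ℕ → (ℕ → Bool) → EReal
  | 0, _ => 1
  | n + 1, ε => fSgn a (ε 0) (uSeq a n (fun k => ε (k + 1)))

/-- `ε` represents `t` if `(u_{n,ε})_n` tends to `t` in `EReal`. -/
def Represents (a : ℝ) (ε : ℕ → Bool) (t : EReal) : Prop :=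
  Filter.Tendsto (fun n => uSeq a n ε) Filter.atTop (nhds t)

/-- `t` is representable if some sign sequence represents it. -/
def Representable (a : ℝ) (t : EReal) : Prop :=
  ∃ ε : ℕ → Bool, Represents a ε t

/-- For a finite word `γ = γ₁⋯γ_k`, `fWord a γ = f_{γ₁} ∘ ⋯ ∘ f_{γ_k}`. -/
noncomputable def fWord (a : ℝ) (γ : List Bool) (x : EReal) : EReal :=
  γ.foldr (fSgn a) x

/-- `I(ε) = ⋂ₙ I(n,ε)` where `I(n,ε)` is the image of `EReal` under `f_{ε₁} ∘ ⋯ ∘ f_{ε_n}`. -/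
noncomputable def Iset (a : ℝ) (ε : ℕ → Bool) : Set EReal :=
  ⋂ n : ℕ, Set.range (fWord a (List.ofFn fun i : Fin n => ε i))

/-- `X` is the union over all finite words `γ` of the images `f_γ(]m,+∞])`. -/
noncomputable def Xset (a m : ℝ) : Set EReal :=
  ⋃ γ : List Bool, fWord a γ '' Set.Ioi (m : EReal)


lemma aux_eexp_nonneg (y : EReal) : 0 ≤ eexp y := by
  unfold eexp
  split_ifs
  · exact le_rfl
  · exact le_top
  · exact_mod_cast (Real.exp_pos _).le

lemma aux_eexp_mono : Monotone eexp := by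
  intro x y h
  by_cases hx : x = ⊥
  · have : eexp x = 0 := by simp [eexp, hx]
    rw [this]
    exact aux_eexp_nonneg y
  by_cases hy : y = ⊤
  · have : eexp y = ⊤ := by simp [eexp, hy]
    rw [this]
    exact le_top
  have hx' : x ≠ ⊤ := fun h' => hy (top_le_iff.1 (h' ▸ h))
  have hy' : y ≠ ⊥ := fun h' => hx (le_bot_iff.1 (h' ▸ h))
  simp only [eexp, hx, hy, hx', hy', if_false]
  exact_mod_cast Real.exp_le_exp.2 (EReal.toReal_le_toReal h hx hy)

lemma aux_mono (a : ℝ) (ha : 0 < a) : Monotone (fun x : EReal => eexp ((a : EReal) * x)) := by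
  intro x y h
  apply aux_eexp_mono
  exact mul_le_mul_of_nonneg_left h (by exact_mod_cast ha.le)

/-- Separation of the two sequences by a point. -/
lemma aux_sep (a : ℝ) (ha : 0 < a) (k : ℕ) : ∀ ε δ : ℕ → Bool, (∀ i < k, ε i = δ i) → ε k ≠ δ k →
    ∃ c : EReal, (∀ n > k, uSeq a n ε ≤ c ∧ c ≤ uSeq a n δ) ∨
      (∀ n > k, c ≤ uSeq a n ε ∧ uSeq a n δ ≤ c) := by
  induction k with
  | zero =>
    intro ε δ _ hne
    refine ⟨0, ?_⟩
    have hp : ∀ (η : ℕ → Bool), η 0 = true → ∀ n > 0, 0 ≤ uSeq a n η := by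
      intro η h n hn
      obtain ⟨m, rfl⟩ := Nat.exists_eq_succ_of_ne_zero hn.ne'
      simp only [uSeq, fSgn, h, if_true]
      exact aux_eexp_nonneg _
    have hm : ∀ (η : ℕ → Bool), η 0 = false → ∀ n > 0, uSeq a n η ≤ 0 := by
      intro η h n hn
      obtain ⟨m, rfl⟩ := Nat.exists_eq_succ_of_ne_zero hn.ne'
      simp only [uSeq, fSgn, h]
      simpa using aux_eexp_nonneg _
    cases h1 : ε 0 <;> cases h2 : δ 0
    · simp [h1, h2] at hne
    · exact Or.inl fun n hn => ⟨hm _ h1 n hn, hp _ h2 n hn⟩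
    · exact Or.inr fun n hn => ⟨hp _ h1 n hn, hm _ h2 n hn⟩
    · simp [h1, h2] at hne
  | succ k ih =>
    intro ε δ heq hne
    obtain ⟨c, hc⟩ := ih (fun i => ε (i + 1)) (fun i => δ (i + 1))
      (fun i hi => heq (i + 1) (by omega)) hne
    refine ⟨fSgn a (ε 0) c, ?_⟩
    have h0 : δ 0 = ε 0 := (heq 0 (by omega)).symm
    have hM := aux_mono a ha
    cases h1 : ε 0
    · rw [h1] at h0
      rcases hc with hc | hc
      · right
        intro n hn
        obtain ⟨m, rfl⟩ := Nat.exists_eq_succ_of_ne_zero (show n ≠ 0 by omega)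
        have := hc m (by omega)
        simp only [uSeq, fSgn, h0, h1]
        simpa using And.intro (hM this.1) (hM this.2)
      · left
        intro n hn
        obtain ⟨m, rfl⟩ := Nat.exists_eq_succ_of_ne_zero (show n ≠ 0 by omega)
        have := hc m (by omega)
        simp only [uSeq, fSgn, h0, h1]
        simpa using And.intro (hM this.1) (hM this.2)
    · rw [h1] at h0
      rcases hc with hc | hc
      · left
        intro n hn
        obtain ⟨m, rfl⟩ := Nat.exists_eq_succ_of_ne_zero (show n ≠ 0 by omega)
        have := hc m (by omega)
        simp only [uSeq, fSgn, h0, h1]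
        simpa using And.intro (hM this.1) (hM this.2)
      · right
        intro n hn
        obtain ⟨m, rfl⟩ := Nat.exists_eq_succ_of_ne_zero (show n ≠ 0 by omega)
        have := hc m (by omega)
        simp only [uSeq, fSgn, h0, h1]
        simpa using And.intro (hM this.1) (hM this.2)

lemma aux_disj (u v : ℕ → EReal) (c : EReal) (k : ℕ) (h : ∀ n > k, u n ≤ c ∧ c ≤ v n) :
    limsup u atTop ≤ liminf v atTop := by
  have h1 : limsup u atTop ≤ c := by
    apply limsup_le_of_le
    · isBoundedDefault
    · filter_upwards [eventually_gt_atTop k] with n hn using (h n hn).1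
  have h2 : c ≤ liminf v atTop := by
    apply le_liminf_of_le
    · isBoundedDefault
    · filter_upwards [eventually_gt_atTop k] with n hn using (h n hn).2
  exact h1.trans h2

lemma aux_countable (a : ℝ) (ha : 0 < a) :
    {ε : ℕ → Bool | ¬ ∃ t : EReal, Represents a ε t}.Countable := by
  have hd : ({ε : ℕ → Bool | ¬ ∃ t : EReal, Represents a ε t}).PairwiseDisjoint
      (fun ε => Set.Ioo (liminf (fun n => uSeq a n ε) atTop)
        (limsup (fun n => uSeq a n ε) atTop)) := by
    intro ε _ δ _ hne
    have hex : ∃ k, ε k ≠ δ k := Function.ne_iff.1 hne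
    classical
    obtain ⟨c, hc⟩ := aux_sep a ha (Nat.find hex) ε δ
      (fun i hi => not_not.1 (Nat.find_min hex hi)) (Nat.find_spec hex)
    apply Set.disjoint_left.2
    rintro x ⟨h1, h2⟩ ⟨h3, h4⟩
    rcases hc with hc | hc
    · exact absurd (h2.trans_le (aux_disj _ _ c _ hc)) (not_lt.2 h3.le)
    · exact absurd (h4.trans_le (aux_disj _ _ c _ (fun n hn => (hc n hn).symm)))
        (not_lt.2 h1.le)
  refine hd.countable_of_isOpen (fun _ _ => isOpen_Ioo) ?_
  intro ε hε
  rw [Set.nonempty_Ioo]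
  by_contra hlt
  apply hε
  refine ⟨liminf (fun n => uSeq a n ε) atTop, ?_⟩
  refine tendsto_of_liminf_eq_limsup rfl ?_
  exact le_antisymm (not_lt.1 hlt) (liminf_le_limsup)

/-- For every `a > 0`, the set of sign sequences `ε` for which `(u_{n,ε})_n`
has no limit in `EReal` is at most countable; consequently some element of `EReal`
is representable. -/
theorem countable_nonconvergent_and_exists_representable (a : ℝ) (ha : 0 < a) :
    {ε : ℕ → Bool | ¬ ∃ t : EReal, Represents a ε t}.Countable ∧
    ∃ t : EReal, Representable a t := by
  refine ⟨aux_countable a ha, ?_⟩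
  by_contra hno
  have huniv : {ε : ℕ → Bool | ¬ ∃ t : EReal, Represents a ε t} = Set.univ := by
    ext ε
    simp only [Set.mem_ofPred_eq, Set.mem_univ, iff_true]
    rintro ⟨t, ht⟩
    exact hno ⟨t, ε, ht⟩
  have h3 : Cardinal.mk (ℕ → Bool) = 2 ^ Cardinal.aleph0 := by simp
  have hc := aux_countable a ha
  rw [huniv, Set.countable_univ_iff] at hc
  have h2 : Cardinal.mk (ℕ → Bool) ≤ Cardinal.aleph0 := Cardinal.mk_le_aleph0_iff.2 hc
  rw [h3] at h2
  exact absurd h2 (not_le.2 (Cardinal.cantor _))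
end

section
/- If 0 < a ≤ 1/e, then for every sign sequence ε the sequence (u_{n,ε})_n has a limit in the extended real line EReal; that is, every sign sequence represents an element of EReal. -/
open Filter Topology

noncomputable def gR (a : ℝ) (s : Bool) (x : ℝ) : ℝ :=
  if s then Real.exp (a * x) else -Real.exp (a * x)

noncomputable def vR (a : ℝ) : ℕ → (ℕ → Bool) → ℝ
  | 0, _ => 1
  | n + 1, ε => gR a (ε 0) (vR a n (fun k => ε (k + 1)))

/-- The modulus of contraction. -/
noncomputable def phiR (d : ℝ) : ℝ := Real.exp 1 * (1 - Real.exp (-(d / Real.exp 1)))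

lemma fSgn_coe (a : ℝ) (s : Bool) (x : ℝ) : fSgn a s (x : EReal) = (gR a s x : ℝ) := by
  have h : eexp ((a : EReal) * (x : EReal)) = ((Real.exp (a * x) : ℝ) : EReal) := by
    rw [← EReal.coe_mul]
    unfold eexp
    rw [if_neg (EReal.coe_ne_bot _), if_neg (EReal.coe_ne_top _), EReal.toReal_coe]
  unfold fSgn gR
  rw [h]
  cases s <;> simp

lemma uSeq_coe (a : ℝ) (n : ℕ) : ∀ ε, uSeq a n ε = (vR a n ε : ℝ) := by
  induction n with
  | zero => intro ε; simp [uSeq, vR]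
  | succ n ih => intro ε; simp only [uSeq, vR]; rw [ih, fSgn_coe]

lemma exp_bound (a : ℝ) (ha : 0 < a) (ha' : a ≤ 1 / Real.exp 1) (x : ℝ)
    (hx : |x| ≤ Real.exp 1) : Real.exp (a * x) ≤ Real.exp 1 := by
  have he := Real.exp_pos 1
  rw [Real.exp_le_exp]
  have h1 : a * Real.exp 1 ≤ 1 := by rwa [le_div_iff₀ he] at ha'
  have h2 := (abs_le.mp hx).2
  nlinarith

lemma gR_bound (a : ℝ) (ha : 0 < a) (ha' : a ≤ 1 / Real.exp 1) (s : Bool) (x : ℝ)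
    (hx : |x| ≤ Real.exp 1) : |gR a s x| ≤ Real.exp 1 := by
  have h := exp_bound a ha ha' x hx
  unfold gR
  cases s <;> simpa using h

lemma vR_bound (a : ℝ) (ha : 0 < a) (ha' : a ≤ 1 / Real.exp 1) (n : ℕ) :
    ∀ ε, |vR a n ε| ≤ Real.exp 1 := by
  induction n with
  | zero => intro ε; simp [vR]
  | succ n ih => intro ε; exact gR_bound a ha ha' _ _ (ih _)

lemma exp_contr (a : ℝ) (ha : 0 < a) (ha' : a ≤ 1 / Real.exp 1) (x y : ℝ)
    (hx : |x| ≤ Real.exp 1) (hxy : y ≤ x) :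
    Real.exp (a * x) - Real.exp (a * y) ≤ phiR (x - y) := by
  have he := Real.exp_pos 1
  have h1 : Real.exp (a * y) = Real.exp (a * x) * Real.exp (-(a * (x - y))) := by
    rw [← Real.exp_add]; ring_nf
  have h2 := exp_bound a ha ha' x hx
  have h3 : Real.exp (-((x - y) / Real.exp 1)) ≤ Real.exp (-(a * (x - y))) := by
    rw [Real.exp_le_exp, neg_le_neg_iff, div_eq_mul_one_div, mul_comm]
    exact mul_le_mul_of_nonneg_left ha' (sub_nonneg.mpr hxy)
  have h4 : Real.exp (-(a * (x - y))) ≤ 1 := by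
    rw [Real.exp_le_one_iff]
    have := mul_nonneg ha.le (sub_nonneg.mpr hxy)
    linarith
  unfold phiR
  rw [h1]
  calc _ = Real.exp (a * x) * (1 - Real.exp (-(a * (x - y)))) := by ring
    _ ≤ Real.exp 1 * (1 - Real.exp (-(a * (x - y)))) :=
        mul_le_mul_of_nonneg_right h2 (by linarith)
    _ ≤ _ := mul_le_mul_of_nonneg_left (by linarith) he.le

lemma gR_contr (a : ℝ) (ha : 0 < a) (ha' : a ≤ 1 / Real.exp 1) (s : Bool) (x y : ℝ)
    (hx : |x| ≤ Real.exp 1) (hy : |y| ≤ Real.exp 1) :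
    |gR a s x - gR a s y| ≤ phiR |x - y| := by
  have key : |Real.exp (a * x) - Real.exp (a * y)| ≤ phiR |x - y| := by
    rcases le_total y x with h | h
    · have h1 : Real.exp (a * y) ≤ Real.exp (a * x) :=
        Real.exp_le_exp.mpr (mul_le_mul_of_nonneg_left h ha.le)
      rw [abs_of_nonneg (sub_nonneg.mpr h), abs_of_nonneg (sub_nonneg.mpr h1)]
      exact exp_contr a ha ha' x y hx h
    · have h1 : Real.exp (a * x) ≤ Real.exp (a * y) :=
        Real.exp_le_exp.mpr (mul_le_mul_of_nonneg_left h ha.le)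
      rw [abs_sub_comm, abs_sub_comm x y, abs_of_nonneg (sub_nonneg.mpr h),
        abs_of_nonneg (sub_nonneg.mpr h1)]
      exact exp_contr a ha ha' y x hy h
  unfold gR
  cases s
  · simp only [Bool.false_eq_true, if_false]
    rw [neg_sub_neg, abs_sub_comm]
    exact key
  · simpa using key

lemma phiR_mono : Monotone phiR := by
  intro x y h
  unfold phiR
  have he := Real.exp_pos 1
  gcongr

lemma phiR_le (d : ℝ) : phiR d ≤ d := by
  have he := Real.exp_pos 1
  have h := Real.add_one_le_exp (-(d / Real.exp 1))
  unfold phiR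
  calc _ ≤ Real.exp 1 * (d / Real.exp 1) := mul_le_mul_of_nonneg_left (by linarith) he.le
    _ = d := by field_simp

lemma phiR_zero : phiR 0 = 0 := by simp [phiR]

lemma phiR_fixed (d : ℝ) (h : phiR d = d) : d = 0 := by
  by_contra hd
  have he := Real.exp_pos 1
  have hne : -(d / Real.exp 1) ≠ 0 := neg_ne_zero.mpr (div_ne_zero hd he.ne')
  have h1 := Real.add_one_lt_exp hne
  have : phiR d < d := by
    unfold phiR
    calc _ < Real.exp 1 * (d / Real.exp 1) := mul_lt_mul_of_pos_left (by linarith) he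
      _ = d := by field_simp
  exact absurd h this.ne

lemma phiR_iter (c : ℝ) (hc : 0 ≤ c) : Tendsto (fun n => phiR^[n] c) atTop (𝓝 0) := by
  have hanti : Antitone (fun n => phiR^[n] c) := by
    apply antitone_nat_of_succ_le
    intro n
    rw [Function.iterate_succ_apply']
    exact phiR_le _
  have hnn : ∀ n, 0 ≤ phiR^[n] c := by
    intro n
    induction n with
    | zero => simpa using hc
    | succ n ih =>
      rw [Function.iterate_succ_apply', ← phiR_zero]
      exact phiR_mono ih
  have hb : BddBelow (Set.range (fun n => phiR^[n] c)) := ⟨0, by rintro _ ⟨n, rfl⟩; exact hnn n⟩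
  have ht := tendsto_atTop_ciInf hanti hb
  have hcont : Continuous phiR := by unfold phiR; fun_prop
  have hfix := isFixedPt_of_tendsto_iterate ht hcont.continuousAt
  rwa [phiR_fixed _ hfix] at ht

lemma vR_dist (a : ℝ) (ha : 0 < a) (ha' : a ≤ 1 / Real.exp 1) (m n : ℕ) :
    ∀ ε, |vR a n ε - vR a (n + m) ε| ≤ phiR^[n] (2 * Real.exp 1) := by
  induction n with
  | zero =>
    intro ε
    have h1 := abs_le.mp (vR_bound a ha ha' 0 ε)
    have h2 := abs_le.mp (vR_bound a ha ha' (0 + m) ε)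
    rw [Function.iterate_zero_apply, abs_le]
    constructor <;> linarith [h1.1, h1.2, h2.1, h2.2]
  | succ n ih =>
    intro ε
    rw [Function.iterate_succ_apply', Nat.add_right_comm]
    exact (gR_contr a ha ha' _ _ _ (vR_bound a ha ha' _ _) (vR_bound a ha ha' _ _)).trans
      (phiR_mono (ih _))

/-- If `0 < a ≤ 1/e`, every sign sequence represents an element of `EReal`. -/
theorem every_sequence_represents (a : ℝ) (ha : 0 < a) (ha' : a ≤ 1 / Real.exp 1) :
    ∀ ε : ℕ → Bool, ∃ t : EReal, Represents a ε t := by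
  intro ε
  have hC : CauchySeq (fun n => vR a n ε) := by
    refine cauchySeq_of_le_tendsto_0' (fun n => phiR^[n] (2 * Real.exp 1)) ?_
      (phiR_iter _ (by positivity))
    intro n m h
    obtain ⟨k, rfl⟩ := Nat.exists_eq_add_of_le h
    rw [Real.dist_eq]
    exact vR_dist a ha ha' k n ε
  obtain ⟨t, ht⟩ := cauchySeq_tendsto_of_complete hC
  refine ⟨(t : EReal), ?_⟩
  unfold Represents
  simp only [uSeq_coe]
  exact (continuous_coe_real_ereal.tendsto t).comp ht
end

section
/- If 0 < a ≤ 1/e, then the set X is dense in the extended real line EReal; equivalently, every interval of nonzero length in EReal meets X. -/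
open Filter Topology

lemma real_step (a m : ℝ) (ha : 0 < a) (S : Set ℝ) (s : ℝ)
    (hS : ∀ x ∈ S, s * Real.exp (a * x) ∈ S)
    (hlow : ∀ x, x < -m → x ∈ S) (p q : ℝ) (hp : 0 ≤ p) (hpq : p < q) (hq : q ≤ m)
    (hgap : ∀ x, p < x → x < q → s * x ∉ S) :
    ∃ p' q' : ℝ, p' < q' ∧ (∀ x, p' < x → x < q' → x ∉ S) ∧
      q - p ≤ m * (1 - Real.exp (-(a * (q' - p')))) := by
  have hlog : ∀ x, 0 < x → Real.exp (a * (Real.log x / a)) = x := by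
    intro x hx
    rw [mul_div_cancel₀ _ ha.ne', Real.exp_log hx]
  have hp0 : 0 < p := by
    rcases hp.lt_or_eq with h | h
    · exact h
    exfalso
    subst h
    have he := Real.exp_pos (a * (-m))
    obtain ⟨x, hx0, hx⟩ := exists_between (lt_min hpq he)
    have hxq := lt_of_lt_of_le hx (min_le_left _ _)
    have hxe := lt_of_lt_of_le hx (min_le_right _ _)
    apply hgap x hx0 hxq
    have h := hS (Real.log x / a) (hlow _ ?_)
    · rwa [hlog x hx0] at h
    · rw [div_lt_iff₀ ha, Real.log_lt_iff_lt_exp hx0, mul_comm]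
      exact hxe
  have hq0 : 0 < q := hp0.trans hpq
  refine ⟨Real.log p / a, Real.log q / a, ?_, ?_, ?_⟩
  · exact div_lt_div_of_pos_right (Real.log_lt_log hp0 hpq) ha
  · intro x h1 h2 hx
    rw [div_lt_iff₀ ha, mul_comm, Real.log_lt_iff_lt_exp hp0] at h1
    rw [lt_div_iff₀ ha, mul_comm, Real.lt_log_iff_exp_lt hq0] at h2
    exact hgap _ h1 h2 (hS x hx)
  · have h1 : -(a * (Real.log q / a - Real.log p / a)) = Real.log p - Real.log q := by
      field_simp; ring
    rw [h1, Real.exp_sub, Real.exp_log hp0, Real.exp_log hq0]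
    have h2 : q - p = q * (1 - p / q) := by field_simp
    rw [h2]
    apply mul_le_mul_of_nonneg_right hq
    rw [sub_nonneg, div_le_one hq0]
    exact hpq.le

lemma real_no_gap (a m : ℝ) (ha : 0 < a) (hm0 : 0 < m) (ham : a * m ≤ 1)
    (hm : Real.exp (a * m) = m) (S : Set ℝ)
    (h0 : (0 : ℝ) ∈ S) (h1 : ∀ x, m < x → x ∈ S)
    (h2 : ∀ x ∈ S, Real.exp (a * x) ∈ S) (h3 : ∀ x ∈ S, -Real.exp (a * x) ∈ S)
    (p q : ℝ) (hpq : p < q) (hgap : ∀ x, p < x → x < q → x ∉ S) : False := by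
  have hlow : ∀ x, x < -m → x ∈ S := by
    intro x hx
    have hx0 : 0 < -x := by linarith
    have h := h3 (Real.log (-x) / a) (h1 _ ?_)
    · rwa [mul_div_cancel₀ _ ha.ne', Real.exp_log hx0, neg_neg] at h
    · rw [lt_div_iff₀ ha, Real.lt_log_iff_exp_lt hx0, mul_comm, hm]
      linarith
  have hb : ∀ p q : ℝ, p < q → (∀ x, p < x → x < q → x ∉ S) → -m ≤ p ∧ q ≤ m := by
    intro p q hpq hg
    constructor
    · by_contra! h
      obtain ⟨x, hx0, hx⟩ := exists_between (lt_min hpq h)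
      exact hg x hx0 (lt_of_lt_of_le hx (min_le_left _ _))
        (hlow x (lt_of_lt_of_le hx (min_le_right _ _)))
    · by_contra! h
      obtain ⟨x, hx0, hx⟩ := exists_between (max_lt hpq h)
      exact hg x (lt_of_le_of_lt (le_max_left _ _) hx0) hx
        (h1 x (lt_of_le_of_lt (le_max_right _ _) hx0))
  have hstep : ∀ p q : ℝ, p < q → (∀ x, p < x → x < q → x ∉ S) →
      ∃ p' q' : ℝ, p' < q' ∧ (∀ x, p' < x → x < q' → x ∉ S) ∧
      q - p ≤ m * (1 - Real.exp (-(a * (q' - p')))) := by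
    intro p q hpq hg
    obtain ⟨hbp, hbq⟩ := hb p q hpq hg
    by_cases hp : 0 ≤ p
    · apply real_step a m ha S 1 (by simpa using h2) hlow p q hp hpq hbq
      simpa using hg
    · have hq : q ≤ 0 := by
        by_contra! h
        exact hg 0 (by linarith) h h0
      have := real_step a m ha S (-1) (by simpa using h3) hlow (-q) (-p) (by linarith)
        (by linarith) (by linarith) (by
          intro x hx1 hx2
          apply hg
          · linarith
          · linarith)
      obtain ⟨p', q', e1, e2, e3⟩ := this
      exact ⟨p', q', e1, e2, by linarith⟩
  let G : Set ℝ := {L | ∃ p q : ℝ, p < q ∧ (∀ x, p < x → x < q → x ∉ S) ∧ L = q - p}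
  have hGb : BddAbove G := by
    refine ⟨2 * m, ?_⟩
    rintro L ⟨p, q, hpq, hg, rfl⟩
    obtain ⟨hbp, hbq⟩ := hb p q hpq hg
    linarith
  have hmem : q - p ∈ G := ⟨p, q, hpq, hgap, rfl⟩
  have hpos : 0 < sSup G := lt_of_lt_of_le (sub_pos.2 hpq) (le_csSup hGb hmem)
  have hle : sSup G ≤ m * (1 - Real.exp (-(a * sSup G))) := by
    apply csSup_le ⟨_, hmem⟩
    rintro L ⟨p, q, hpq, hg, rfl⟩
    obtain ⟨p', q', e1, e2, e3⟩ := hstep p q hpq hg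
    have : q' - p' ≤ sSup G := le_csSup hGb ⟨p', q', e1, e2, rfl⟩
    refine e3.trans ?_
    gcongr
  have hlt := Real.add_one_lt_exp (x := -(a * sSup G)) (by
    have := mul_pos ha hpos
    linarith)
  have : m * (1 - Real.exp (-(a * sSup G))) < m * (a * sSup G) := by
    apply mul_lt_mul_of_pos_left _ hm0
    linarith
  nlinarith

lemma fSgn_mem (a m : ℝ) (s : Bool) (x : EReal) (hx : x ∈ Xset a m) :
    fSgn a s x ∈ Xset a m := by
  simp only [Xset, Set.mem_iUnion] at hx ⊢
  obtain ⟨γ, y, hy, rfl⟩ := hx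
  exact ⟨s :: γ, y, hy, rfl⟩

lemma eexp_coe (x : ℝ) : eexp (x : EReal) = (Real.exp x : ℝ) := by
  simp [eexp]

/-- If `0 < a ≤ 1/e` and `m` is the smallest real fixed point of `x ↦ e^{a·x}`,
then `X` is dense in `EReal`. -/
theorem dense_X (a m : ℝ) (ha : 0 < a) (ha' : a ≤ 1 / Real.exp 1)
    (hm : Real.exp (a * m) = m) (hmin : ∀ m' : ℝ, Real.exp (a * m') = m' → m ≤ m') :
    Dense (Xset a m) := by
  have hm0 : 0 < m := hm ▸ Real.exp_pos _
  have ham : a * m ≤ 1 := by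
    have hc : ContinuousOn (fun x : ℝ => Real.exp (a * x) - x) (Set.Icc 0 (1 / a)) := by
      fun_prop
    have hiv := intermediate_value_Icc' (by positivity : (0 : ℝ) ≤ 1 / a) hc
    have hmem : (0 : ℝ) ∈ Set.Icc (Real.exp (a * (1 / a)) - 1 / a) (Real.exp (a * 0) - 0) := by
      constructor
      · rw [mul_one_div_cancel ha.ne', sub_nonpos, le_div_iff₀ ha]
        rw [le_div_iff₀ (Real.exp_pos 1)] at ha'
        linarith
      · simp
    obtain ⟨x, hx, hx'⟩ := hiv hmem
    have := hmin x (by simpa [sub_eq_zero] using hx')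
    have h := this.trans hx.2
    rw [le_div_iff₀ ha] at h
    linarith
  have hIoi : ∀ x : EReal, (m : EReal) < x → x ∈ Xset a m := by
    intro x hx
    simp only [Xset, Set.mem_iUnion]
    exact ⟨[], x, hx, rfl⟩
  have hbot : (⊥ : EReal) ∈ Xset a m := by
    have h := fSgn_mem a m false ⊤ (hIoi _ (EReal.coe_lt_top m))
    simpa [fSgn, eexp, EReal.coe_mul_top_of_pos ha] using h
  have hzero : (0 : EReal) ∈ Xset a m := by
    have h := fSgn_mem a m true ⊥ hbot
    simpa [fSgn, eexp, EReal.coe_mul_bot_of_pos ha] using h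
  apply dense_of_exists_between
  intro u v huv
  by_contra! hno
  obtain ⟨p, hup, hpv⟩ := EReal.lt_iff_exists_real_btwn.1 huv
  obtain ⟨q, hpq, hqv⟩ := EReal.lt_iff_exists_real_btwn.1 hpv
  refine real_no_gap a m ha hm0 ham hm {x : ℝ | (x : EReal) ∈ Xset a m} (by simpa using hzero)
    (fun x hx => hIoi _ (EReal.coe_lt_coe_iff.2 hx)) ?_ ?_ p q (EReal.coe_lt_coe_iff.1 hpq) ?_
  · intro x hx
    have h := fSgn_mem a m true x hx
    simpa [fSgn, ← EReal.coe_mul, eexp_coe] using h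
  · intro x hx
    have h := fSgn_mem a m false x hx
    simpa [fSgn, ← EReal.coe_mul, eexp_coe] using h
  · intro x h1 h2 hx
    exact hno _ hx ⟨hup.trans (EReal.coe_lt_coe_iff.2 h1),
      (EReal.coe_lt_coe_iff.2 h2).trans hqv⟩
end

section
/- If 0 < a ≤ 1/e, then there exists a real number m with e^{a·m} = m and m ≤ 1/a, m is the smallest real fixed point of x ↦ e^{a·x} (i.e., every real m' with e^{a·m'} = m' satisfies m ≤ m'), and the real sequence defined by v₀ = 1 and v_{n+1} = e^{a·v_n} converges to m. -/
open Filter Topology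

/-- If `0 < a ≤ 1/e` then `x ↦ e^{a·x}` has a smallest real fixed point `m`,
it satisfies `m ≤ 1/a`, and the sequence `v₀ = 1`, `v_{n+1} = e^{a·v_n}` converges to `m`. -/
theorem exists_least_fixed_point_and_tendsto (a : ℝ) (ha : 0 < a) (ha' : a ≤ 1 / Real.exp 1)
    (v : ℕ → ℝ) (hv0 : v 0 = 1) (hv : ∀ n, v (n + 1) = Real.exp (a * v n)) :
    ∃ m : ℝ, Real.exp (a * m) = m ∧ m ≤ 1 / a ∧
      (∀ m' : ℝ, Real.exp (a * m') = m' → m ≤ m') ∧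
      Filter.Tendsto v Filter.atTop (nhds m) := by
  have hae : Real.exp 1 ≤ 1 / a := by
    rw [le_div_iff₀ ha]
    rw [le_div_iff₀ (Real.exp_pos 1)] at ha'
    linarith
  have hmono : Monotone v := by
    apply monotone_nat_of_le_succ
    intro n
    induction n with
    | zero =>
      rw [hv, hv0]
      exact Real.one_le_exp (by linarith)
    | succ k ih =>
      rw [hv (k + 1), hv k]
      rw [hv k] at ih
      exact Real.exp_le_exp.mpr (mul_le_mul_of_nonneg_left ih ha.le)
  have hbd : ∀ n, v n ≤ 1 / a := by
    intro n
    induction n with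
    | zero =>
      rw [hv0]
      exact le_trans (Real.one_le_exp zero_le_one) hae
    | succ k ih =>
      rw [hv k]
      refine le_trans (Real.exp_le_exp.mpr ?_) hae
      rw [le_div_iff₀ ha] at ih
      linarith
  obtain ⟨m, hm⟩ : ∃ m, Tendsto v atTop (𝓝 m) :=
    ⟨_, tendsto_atTop_ciSup hmono ⟨1 / a, by rintro _ ⟨n, rfl⟩; exact hbd n⟩⟩
  refine ⟨m, ?_, le_of_tendsto' hm hbd, ?_, hm⟩
  · have h1 : Tendsto (fun n => v (n + 1)) atTop (𝓝 m) := (tendsto_add_atTop_iff_nat 1).mpr hm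
    have h2 : Tendsto (fun n => Real.exp (a * v n)) atTop (𝓝 (Real.exp (a * m))) :=
      (Real.continuous_exp.tendsto _).comp (hm.const_mul a)
    simp only [hv] at h1
    exact tendsto_nhds_unique h2 h1
  · intro m' hm'
    refine le_of_tendsto' hm ?_
    intro n
    induction n with
    | zero =>
      have hpos : 0 < m' := hm' ▸ Real.exp_pos (a * m')
      rw [hv0, ← hm']
      exact Real.one_le_exp (by positivity)
    | succ k ih =>
      rw [hv k, ← hm']
      exact Real.exp_le_exp.mpr (mul_le_mul_of_nonneg_left ih ha.le)
end

section
/- If a > e, then there exist real numbers x < y such that no element of the open interval (x, y) ⊆ EReal is representable; in particular, some element of EReal is not representable. -/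
open Filter Topology

/-- Real-valued version of `uSeq`. -/
noncomputable def ruSeq (a : ℝ) : ℕ → (ℕ → Bool) → ℝ
  | 0, _ => 1
  | n + 1, ε => if ε 0 then Real.exp (a * ruSeq a n (fun k => ε (k + 1)))
      else -Real.exp (a * ruSeq a n (fun k => ε (k + 1)))

lemma uSeq_eq_coe (a : ℝ) (n : ℕ) : ∀ ε : ℕ → Bool, uSeq a n ε = (ruSeq a n ε : EReal) := by
  induction n with
  | zero => intro ε; simp [uSeq, ruSeq]
  | succ n ih =>
    intro ε
    have h : ∀ r : ℝ, eexp (r : EReal) = (Real.exp r : EReal) := by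
      intro r; simp [eexp]
    simp only [uSeq, ruSeq, ih, fSgn]
    rw [← EReal.coe_mul, h]
    split_ifs <;> simp

lemma represents_coe (a : ℝ) (ε : ℕ → Bool) (t : ℝ) :
    Represents a ε (t : EReal) ↔ Tendsto (fun n => ruSeq a n ε) atTop (𝓝 t) := by
  unfold Represents
  simp only [uSeq_eq_coe]
  exact EReal.tendsto_coe

lemma step (a : ℝ) (ha : Real.exp 1 < a) (ε : ℕ → Bool) (t : ℝ)
    (h1 : -Real.exp (-1) < t) (h2 : t < -a⁻¹)
    (h : Tendsto (fun n => ruSeq a n ε) atTop (𝓝 t)) :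
    ε 0 = false ∧ ∃ t' : ℝ, -Real.exp (-1) < t' ∧ t' < -a⁻¹ ∧
      Tendsto (fun n => ruSeq a n (fun k => ε (k + 1))) atTop (𝓝 t') := by
  have ha0 : 0 < a := (Real.exp_pos 1).trans ha
  have hai : 0 < a⁻¹ := inv_pos.2 ha0
  have h' := (tendsto_add_atTop_iff_nat 1).2 h
  have e0 : ε 0 = false := by
    by_contra hc
    have hc : ε 0 = true := by simpa using hc
    have : 0 ≤ t := ge_of_tendsto' h' (fun n => by simp [ruSeq, hc, Real.exp_nonneg])
    linarith
  refine ⟨e0, Real.log (-t) / a, ?_, ?_, ?_⟩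
  · have l1 : -Real.log a < Real.log (-t) := by
      rw [← Real.log_inv]
      exact Real.log_lt_log hai (by linarith)
    have l2 : Real.log a ≤ a * Real.exp (-1) := by
      have := Real.log_le_sub_one_of_pos (mul_pos ha0 (Real.exp_pos (-1)))
      rw [Real.log_mul ha0.ne' (Real.exp_pos _).ne', Real.log_exp] at this
      linarith
    rw [lt_div_iff₀ ha0]
    linarith
  · have l1 : Real.log (-t) < -1 := by
      rw [Real.log_lt_iff_lt_exp (by linarith)]
      linarith
    rw [div_lt_iff₀ ha0, neg_mul, inv_mul_cancel₀ ha0.ne']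
    exact l1
  · have := ((h'.neg).log (show -t ≠ 0 by intro hz; linarith)).div_const a
    refine this.congr (fun n => ?_)
    simp only [ruSeq, e0]
    simp [ha0.ne']

lemma all_false (a : ℝ) (ha : Real.exp 1 < a) (n : ℕ) : ∀ (ε : ℕ → Bool) (t : ℝ),
    -Real.exp (-1) < t → t < -a⁻¹ →
    Tendsto (fun n => ruSeq a n ε) atTop (𝓝 t) → ε n = false := by
  induction n with
  | zero => intro ε t h1 h2 h; exact (step a ha ε t h1 h2 h).1
  | succ n ih =>
    intro ε t h1 h2 h
    obtain ⟨_, tnew, hlow, hhigh, hlim⟩ := step a ha ε t h1 h2 h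
    exact ih _ tnew hlow hhigh hlim

/-- If `a > e`, there exist reals `x < y` such that no element of the open
interval `(x, y) ⊆ EReal` is representable; in particular some element is not representable. -/
theorem exists_interval_of_nonrepresentable (a : ℝ) (ha : Real.exp 1 < a) :
    (∃ x y : ℝ, x < y ∧ ∀ t ∈ Set.Ioo (x : EReal) (y : EReal), ¬ Representable a t) ∧
      ∃ t : EReal, ¬ Representable a t := by
  have hJ : -Real.exp (-1) < -a⁻¹ := by
    rw [Real.exp_neg]
    exact neg_lt_neg (inv_strictAnti₀ (Real.exp_pos 1) ha)
  have key : ∀ t : ℝ, -Real.exp (-1) < t → t < -a⁻¹ → Representable a (t : EReal) →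
      Tendsto (fun n => ruSeq a n (fun _ => false)) atTop (𝓝 t) := by
    rintro t h1 h2 ⟨ε, h⟩
    rw [represents_coe] at h
    have : ε = fun _ => false := funext fun n => all_false a ha n ε t h1 h2 h
    rwa [this] at h
  obtain ⟨m, hm1, hm2⟩ := exists_between hJ
  have main : ∃ x y : ℝ, x < y ∧ ∀ t ∈ Set.Ioo (x : EReal) (y : EReal), ¬ Representable a t := by
    by_cases hc : ∃ s : ℝ, s < m ∧ -Real.exp (-1) < s ∧ Representable a (s : EReal)
    · obtain ⟨s, hs, hs1, hsr⟩ := hc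
      refine ⟨m, -a⁻¹, hm2, ?_⟩
      rintro t ⟨ht1, ht2⟩ hr
      induction t with
      | bot => simp at ht1
      | top => simp at ht2
      | coe t =>
        rw [EReal.coe_lt_coe_iff] at ht1 ht2
        have := tendsto_nhds_unique (key t (by linarith) ht2 hr) (key s hs1 (by linarith) hsr)
        linarith
    · refine ⟨-Real.exp (-1), m, hm1, ?_⟩
      rintro t ⟨ht1, ht2⟩ hr
      induction t with
      | bot => simp at ht1
      | top => simp at ht2
      | coe t =>
        rw [EReal.coe_lt_coe_iff] at ht1 ht2
        exact hc ⟨t, ht2, ht1, hr⟩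
  refine ⟨main, ?_⟩
  obtain ⟨x, y, hxy, h⟩ := main
  obtain ⟨z, hz1, hz2⟩ := exists_between hxy
  exact ⟨z, h z ⟨EReal.coe_lt_coe_iff.2 hz1, EReal.coe_lt_coe_iff.2 hz2⟩⟩
end

section
/- Let a > 0 and let ε be a sign sequence. (i) If the sequence (u_{n,ε})_n tends to t in EReal, then t belongs to I(ε). (ii) If I(ε) is a subsingleton, then (u_{n,ε})_n converges in EReal, and its limit is the unique element of I(ε). -/
open Filter Topology

theorem eexp_eq_exp (y : EReal) : eexp y = ((EReal.exp y : ENNReal) : EReal) := by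
  induction y with
  | bot => simp [eexp]
  | top => simp [eexp]
  | coe x => simp [eexp, (Real.exp_pos x).le]

theorem continuous_eexp : Continuous eexp := by
  have h : eexp = fun y => ((EReal.exp y : ENNReal) : EReal) := funext eexp_eq_exp
  rw [h]
  exact continuous_coe_ennreal_ereal.comp ENNReal.continuous_exp

theorem continuous_coe_mul_ereal (a : ℝ) (ha : 0 < a) :
    Continuous (fun x : EReal => (a : EReal) * x) := by
  rw [continuous_iff_continuousAt]
  intro x
  have ha0 : (a : EReal) ≠ 0 := by exact_mod_cast ha.ne'
  have h := EReal.continuousAt_mul (p := ((a : EReal), x)) (Or.inl ha0) (Or.inl ha0)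
    (Or.inl (EReal.coe_ne_bot a)) (Or.inl (EReal.coe_ne_top a))
  exact ContinuousAt.comp (f := fun x : EReal => ((a : EReal), x)) h (by fun_prop)

theorem continuous_fSgn (a : ℝ) (ha : 0 < a) (s : Bool) : Continuous (fSgn a s) := by
  have h := continuous_eexp.comp (continuous_coe_mul_ereal a ha)
  cases s
  · have : fSgn a false = fun x => -eexp ((a : EReal) * x) := by funext x; simp [fSgn]
    rw [this]
    exact continuous_neg.comp h
  · have : fSgn a true = fun x => eexp ((a : EReal) * x) := by funext x; simp [fSgn]
    rw [this]
    exact h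

theorem continuous_fWord (a : ℝ) (ha : 0 < a) (γ : List Bool) : Continuous (fWord a γ) := by
  induction γ with
  | nil => exact continuous_id
  | cons s γ ih => exact (continuous_fSgn a ha s).comp ih

theorem uSeq_add_mem (a : ℝ) (n k : ℕ) (ε : ℕ → Bool) :
    uSeq a (n + k) ε ∈ Set.range (fWord a (List.ofFn fun i : Fin n => ε i)) := by
  induction n generalizing ε with
  | zero => exact ⟨_, rfl⟩
  | succ n ih =>
    obtain ⟨x, hx⟩ := ih (fun k => ε (k + 1))
    refine ⟨x, ?_⟩
    rw [Nat.add_right_comm, uSeq, ← hx]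
    simp [fWord, List.ofFn_succ]

theorem cluster_mem_Iset (a : ℝ) (ha : 0 < a) (ε : ℕ → Bool) (t : EReal)
    (h : MapClusterPt t atTop (fun n => uSeq a n ε)) : t ∈ Iset a ε := by
  refine Set.mem_iInter.2 fun n => ?_
  have hc : IsClosed (Set.range (fWord a (List.ofFn fun i : Fin n => ε i))) :=
    (isCompact_range (continuous_fWord a ha _)).isClosed
  refine hc.mem_of_mapClusterPt h ?_
  filter_upwards [eventually_ge_atTop n] with m hm
  obtain ⟨k, rfl⟩ := Nat.exists_eq_add_of_le hm
  exact uSeq_add_mem a n k ε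

/-- (i) if `(u_{n,ε})_n` tends to `t` then `t ∈ I(ε)`;
(ii) if `I(ε)` is a subsingleton then `(u_{n,ε})_n` converges to the unique element of `I(ε)`. -/
theorem limit_mem_Iset_and_converges_of_subsingleton (a : ℝ) (ha : 0 < a) (ε : ℕ → Bool) :
    (∀ t : EReal, Represents a ε t → t ∈ Iset a ε) ∧
      ((Iset a ε).Subsingleton → ∃ t : EReal, t ∈ Iset a ε ∧ Represents a ε t) := by
  refine ⟨fun t ht => cluster_mem_Iset a ha ε t (Filter.Tendsto.mapClusterPt ht), fun hs => ?_⟩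
  obtain ⟨t, ht⟩ := exists_clusterPt_of_compactSpace (map (fun n => uSeq a n ε) atTop)
  have htI := cluster_mem_Iset a ha ε t ht
  exact ⟨t, htI, tendsto_nhds_of_unique_mapClusterPt fun x hx =>
    hs (cluster_mem_Iset a ha ε x hx) htI⟩
end

section
/- Let a > 0. For every element t of EReal there exists at least one sign sequence ε with t ∈ I(ε), and there do not exist three pairwise distinct sign sequences ε, ε', ε'' with t ∈ I(ε), t ∈ I(ε') and t ∈ I(ε''); that is, t belongs to I(ε) for at least one and at most two sign sequences ε. -/
open Filter Topology

theorem aux_bot (a : ℝ) (ha : 0 < a) : eexp ((a : EReal) * ⊥) = 0 := by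
  simp [eexp, EReal.coe_mul_bot_of_pos ha]

theorem aux_top (a : ℝ) (ha : 0 < a) : eexp ((a : EReal) * ⊤) = ⊤ := by
  simp [eexp, EReal.coe_mul_top_of_pos ha]

theorem aux_coe (a r : ℝ) : eexp ((a : EReal) * (r : EReal)) = ((Real.exp (a * r) : ℝ) : EReal) := by
  rw [← EReal.coe_mul]
  simp only [eexp, EReal.coe_ne_bot, EReal.coe_ne_top, if_false, EReal.toReal_coe]

theorem aux_inj (a : ℝ) (ha : 0 < a) (x y : EReal)
    (h : eexp ((a : EReal) * x) = eexp ((a : EReal) * y)) : x = y := by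
  induction x with
  | bot =>
    induction y with
    | bot => rfl
    | coe r =>
      rw [aux_bot a ha, aux_coe] at h
      exact absurd (EReal.coe_eq_coe_iff.1 h) (Real.exp_pos _).ne
    | top => rw [aux_bot a ha, aux_top a ha] at h; exact absurd h EReal.zero_ne_top
  | coe q =>
    induction y with
    | bot =>
      rw [aux_bot a ha, aux_coe] at h
      exact absurd (EReal.coe_eq_coe_iff.1 h) (Real.exp_pos _).ne'
    | coe r =>
      rw [aux_coe, aux_coe, EReal.coe_eq_coe_iff, Real.exp_eq_exp] at h
      rw [mul_left_cancel₀ ha.ne' h]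
    | top => rw [aux_coe, aux_top a ha] at h; exact absurd h (EReal.coe_ne_top _)
  | top =>
    induction y with
    | bot => rw [aux_bot a ha, aux_top a ha] at h; exact absurd h.symm EReal.zero_ne_top
    | coe r => rw [aux_coe, aux_top a ha] at h; exact absurd h.symm (EReal.coe_ne_top _)
    | top => rfl

theorem aux_nonneg (a : ℝ) (x : EReal) : 0 ≤ eexp ((a : EReal) * x) := by
  unfold eexp
  split_ifs
  · exact le_rfl
  · exact le_top
  · exact EReal.coe_nonneg.2 (Real.exp_pos _).le

theorem aux_surj (a : ℝ) (ha : 0 < a) (t : EReal) (ht : 0 ≤ t) :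
    ∃ x : EReal, eexp ((a : EReal) * x) = t := by
  induction t with
  | bot => simp at ht
  | top => exact ⟨⊤, aux_top a ha⟩
  | coe r =>
    rcases (EReal.coe_nonneg.1 ht).eq_or_lt with h | h
    · subst h
      exact ⟨⊥, aux_bot a ha⟩
    · refine ⟨((Real.log r / a : ℝ) : EReal), ?_⟩
      rw [aux_coe, mul_div_cancel₀ _ ha.ne', Real.exp_log h]

theorem fSgn_inj (a : ℝ) (ha : 0 < a) (s : Bool) (x y : EReal)
    (h : fSgn a s x = fSgn a s y) : x = y := by
  cases s
  · simp only [fSgn, Bool.false_eq_true, if_false, neg_inj] at h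
    exact aux_inj a ha x y h
  · simp only [fSgn, if_true] at h
    exact aux_inj a ha x y h

theorem fSgn_surj (a : ℝ) (ha : 0 < a) (t : EReal) :
    ∃ s : Bool, ∃ x : EReal, fSgn a s x = t := by
  rcases le_total 0 t with h | h
  · obtain ⟨x, hx⟩ := aux_surj a ha t h
    exact ⟨true, x, by simp [fSgn, hx]⟩
  · obtain ⟨x, hx⟩ := aux_surj a ha (-t) (by simpa using EReal.neg_le_neg_iff.2 h)
    exact ⟨false, x, by simp [fSgn, hx]⟩

theorem fSgn_tf (a : ℝ) (ha : 0 < a) (x y : EReal)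
    (h : fSgn a true x = fSgn a false y) : x = ⊥ ∧ y = ⊥ := by
  simp only [fSgn, Bool.false_eq_true, if_false, if_true] at h
  have h1 := aux_nonneg a x
  have h2 := aux_nonneg a y
  have h3 : -eexp ((a : EReal) * y) ≤ 0 := by simpa using EReal.neg_le_neg_iff.2 h2
  have hx : eexp ((a : EReal) * x) = 0 := le_antisymm (h ▸ h3) h1
  have hy : eexp ((a : EReal) * y) = 0 := by
    rw [hx] at h
    simpa using h.symm
  exact ⟨aux_inj a ha _ _ (hx.trans (aux_bot a ha).symm),
    aux_inj a ha _ _ (hy.trans (aux_bot a ha).symm)⟩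

theorem fSgn_ne (a : ℝ) (ha : 0 < a) (s s' : Bool) (x y : EReal) (hs : s ≠ s')
    (h : fSgn a s x = fSgn a s' y) : x = ⊥ ∧ y = ⊥ := by
  cases s <;> cases s'
  · exact absurd rfl hs
  · exact (fSgn_tf a ha y x h.symm).symm
  · exact fSgn_tf a ha x y h
  · exact absurd rfl hs

theorem Iset_step (a : ℝ) (ha : 0 < a) (ε : ℕ → Bool) (t : EReal) (h : t ∈ Iset a ε) :
    ∃ x, t = fSgn a (ε 0) x ∧ x ∈ Iset a (fun k => ε (k + 1)) := by
  have key : ∀ n : ℕ, ∃ y, fSgn a (ε 0)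
      (fWord a (List.ofFn fun i : Fin n => ε (i + 1)) y) = t := by
    intro n
    obtain ⟨y, hy⟩ := Set.mem_iInter.1 h (n + 1)
    refine ⟨y, ?_⟩
    rw [← hy]
    simp [fWord, List.ofFn_succ]
  obtain ⟨y, hy⟩ := key 0
  refine ⟨_, hy.symm, Set.mem_iInter.2 fun n => ?_⟩
  obtain ⟨z, hz⟩ := key n
  exact ⟨z, fSgn_inj a ha _ _ _ (hz.trans hy.symm)⟩

theorem Iset_exists (a : ℝ) (ha : 0 < a) (t : EReal) : ∃ ε : ℕ → Bool, t ∈ Iset a ε := by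
  choose s p hp using fSgn_surj a ha
  refine ⟨fun n => s (p^[n] t), Set.mem_iInter.2 fun n => ?_⟩
  induction n generalizing t with
  | zero => exact ⟨t, by simp [fWord]⟩
  | succ n ih =>
    obtain ⟨y, hy⟩ := ih (p t)
    refine ⟨y, ?_⟩
    have : fWord a (List.ofFn fun i : Fin (n + 1) => s (p^[i] t)) y
        = fSgn a (s t) (fWord a (List.ofFn fun i : Fin n => s (p^[i] (p t))) y) := by
      simp [fWord, List.ofFn_succ]
    rw [this, hy, hp]

theorem Iset_top (a : ℝ) (ha : 0 < a) (n : ℕ) (ε : ℕ → Bool) (h : ⊤ ∈ Iset a ε) :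
    ε n = true := by
  obtain ⟨x, hx, hx'⟩ := Iset_step a ha ε ⊤ h
  have ht : fSgn a true ⊤ = ⊤ := by simp [fSgn, aux_top a ha]
  have h0 : ε 0 = true := by
    by_contra hne
    have := (fSgn_ne a ha _ _ _ _ hne (hx.symm.trans ht.symm)).2
    simp at this
  rw [h0] at hx
  have hxt := fSgn_inj a ha _ _ _ (ht.trans hx)
  subst hxt
  cases n with
  | zero => exact h0
  | succ n => exact Iset_top a ha n _ hx'

theorem Iset_bot (a : ℝ) (ha : 0 < a) (ε : ℕ → Bool) (h : ⊥ ∈ Iset a ε) :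
    ε = fun n => decide (n ≠ 0) := by
  obtain ⟨x, hx, hx'⟩ := Iset_step a ha ε ⊥ h
  have ht : fSgn a false ⊤ = ⊥ := by simp [fSgn, aux_top a ha]
  have h0 : ε 0 = false := by
    by_contra hne
    have := (fSgn_ne a ha _ _ _ _ hne (hx.symm.trans ht.symm)).2
    simp at this
  rw [h0] at hx
  have hxt := fSgn_inj a ha _ _ _ (ht.trans hx)
  subst hxt
  funext n
  cases n with
  | zero => simpa using h0
  | succ n => simpa using Iset_top a ha n _ hx'

theorem seq_ext (ε ε' : ℕ → Bool) (h0 : ε 0 = ε' 0)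
    (h : (fun k => ε (k + 1)) = (fun k => ε' (k + 1))) : ε = ε' := by
  funext n
  cases n with
  | zero => exact h0
  | succ n => exact congrFun h n

theorem Iset_two (a : ℝ) (ha : 0 < a) (n : ℕ) : ∀ (t : EReal) (ε ε' ε'' : ℕ → Bool),
    ε n ≠ ε' n → t ∈ Iset a ε → t ∈ Iset a ε' → t ∈ Iset a ε'' → ε'' = ε ∨ ε'' = ε' ∨ ε = ε' := by
  induction n with
  | zero =>
    intro t ε ε' ε'' hn h h' h''
    obtain ⟨x, hx, hxI⟩ := Iset_step a ha _ _ h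
    obtain ⟨y, hy, hyI⟩ := Iset_step a ha _ _ h'
    obtain ⟨z, hz, hzI⟩ := Iset_step a ha _ _ h''
    obtain ⟨rfl, rfl⟩ := fSgn_ne a ha _ _ _ _ hn (hx.symm.trans hy)
    by_cases hc : ε'' 0 = ε 0
    · rw [hc] at hz
      have := fSgn_inj a ha _ _ _ (hz.symm.trans hx)
      subst this
      exact Or.inl (seq_ext _ _ hc ((Iset_bot a ha _ hzI).trans (Iset_bot a ha _ hxI).symm))
    · have hc' : ε'' 0 = ε' 0 := by
        revert hc hn
        cases ε 0 <;> cases ε' 0 <;> cases ε'' 0 <;> simp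
      have := (fSgn_ne a ha _ _ _ _ hc (hz.symm.trans hx)).1
      subst this
      exact Or.inr (Or.inl
        (seq_ext _ _ hc' ((Iset_bot a ha _ hzI).trans (Iset_bot a ha _ hyI).symm)))
  | succ n ih =>
    intro t ε ε' ε'' hn h h' h''
    obtain ⟨x, hx, hxI⟩ := Iset_step a ha _ _ h
    obtain ⟨y, hy, hyI⟩ := Iset_step a ha _ _ h'
    obtain ⟨z, hz, hzI⟩ := Iset_step a ha _ _ h''
    by_cases h0 : ε 0 = ε' 0
    · rw [← h0] at hy
      have := fSgn_inj a ha _ _ _ (hx.symm.trans hy)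
      subst this
      by_cases hc : ε'' 0 = ε 0
      · rw [hc] at hz
        have := fSgn_inj a ha _ _ _ (hz.symm.trans hx)
        subst this
        rcases ih z _ _ _ hn hxI hyI hzI with e | e | e
        · exact Or.inl (seq_ext _ _ hc e)
        · exact Or.inr (Or.inl (seq_ext _ _ (hc.trans h0) e))
        · exact Or.inr (Or.inr (seq_ext _ _ h0 e))
      · have := (fSgn_ne a ha _ _ _ _ hc (hz.symm.trans hx)).2
        subst this
        exact Or.inr (Or.inr
          (seq_ext _ _ h0 ((Iset_bot a ha _ hxI).trans (Iset_bot a ha _ hyI).symm)))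
    · obtain ⟨rfl, rfl⟩ := fSgn_ne a ha _ _ _ _ h0 (hx.symm.trans hy)
      exact absurd (congrFun ((Iset_bot a ha _ hxI).trans (Iset_bot a ha _ hyI).symm) n) hn

/-- Every `t` in `EReal` belongs to `I(ε)` for at least one and at most two
sign sequences `ε`. -/
theorem mem_Iset_one_or_two (a : ℝ) (ha : 0 < a) :
    ∀ t : EReal, (∃ ε : ℕ → Bool, t ∈ Iset a ε) ∧
      ¬ ∃ ε ε' ε'' : ℕ → Bool, ε ≠ ε' ∧ ε ≠ ε'' ∧ ε' ≠ ε'' ∧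
        t ∈ Iset a ε ∧ t ∈ Iset a ε' ∧ t ∈ Iset a ε'' := by
  intro t
  refine ⟨Iset_exists a ha t, ?_⟩
  rintro ⟨ε, ε', ε'', h1, h2, h3, h, h', h''⟩
  obtain ⟨n, hn⟩ := Function.ne_iff.1 h1
  rcases Iset_two a ha n t ε ε' ε'' hn h h' h'' with e | e | e
  · exact h2 e.symm
  · exact h3 e.symm
  · exact h1 e
end

section
/- There exists a unique real number A in the open interval (0,1) such that (A+1)·A^{-1/(A+1)} = e, where the power is the real power function and e = exp(1). -/
open Filter Topology

/-- The logarithmic form of the equation. -/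
noncomputable def gAux (x : ℝ) : ℝ := (x + 1) * Real.log (x + 1) - Real.log x - (x + 1)

lemma gAux_hasDerivAt {x : ℝ} (hx : 0 < x) :
    HasDerivAt gAux (Real.log (x + 1) - 1 / x) x := by
  have h1 : HasDerivAt (fun y : ℝ => y + 1) 1 x := (hasDerivAt_id x).add_const 1
  have hne : x + 1 ≠ 0 := by positivity
  have h2 := h1.log hne
  have h3 := ((h1.mul h2).sub (Real.hasDerivAt_log hx.ne')).sub h1
  refine h3.congr_deriv ?_
  field_simp
  ring

lemma gAux_continuousOn : ContinuousOn gAux (Set.Ioc 0 1) := fun _ hx =>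
  (gAux_hasDerivAt hx.1).continuousAt.continuousWithinAt

lemma gAux_strictAntiOn : StrictAntiOn gAux (Set.Ioc 0 1) := by
  refine strictAntiOn_of_deriv_neg (convex_Ioc 0 1) gAux_continuousOn ?_
  intro x hx
  rw [interior_Ioc] at hx
  obtain ⟨h0, h1⟩ := hx
  rw [(gAux_hasDerivAt h0).deriv]
  have h2 := Real.log_le_sub_one_of_pos (show 0 < x + 1 by linarith)
  have h3 : 1 < 1 / x := (one_lt_div h0).2 h1
  linarith

lemma gAux_iff {x : ℝ} (hx : 0 < x) :
    (x + 1) * Real.rpow x (-1 / (x + 1)) = Real.exp 1 ↔ gAux x = 0 := by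
  have hp : 0 < x + 1 := by linarith
  have hr : 0 < x ^ (-1 / (x + 1)) := Real.rpow_pos_of_pos hx _
  change (x + 1) * x ^ (-1 / (x + 1)) = Real.exp 1 ↔ _
  rw [← Real.log_injOn_pos.eq_iff (mul_pos hp hr) (Real.exp_pos 1), Real.log_exp,
    Real.log_mul hp.ne' hr.ne', Real.log_rpow hx]
  have key : gAux x = (x + 1) * (Real.log (x + 1) + -1 / (x + 1) * Real.log x - 1) := by
    unfold gAux
    field_simp
    ring
  rw [key, mul_eq_zero, sub_eq_zero]
  simp [hp.ne']

/-- There is a unique `A ∈ (0,1)` with `(A+1)·A^{-1/(A+1)} = e`. -/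
theorem exists_unique_A :
    ∃! A : ℝ, A ∈ Set.Ioo (0 : ℝ) 1 ∧
      (A + 1) * Real.rpow A (-1 / (A + 1)) = Real.exp 1 := by
  have h1 : gAux 1 < 0 := by
    have := Real.log_two_lt_d9
    norm_num [gAux]
    linarith
  have he1 : Real.exp (-2) < 1 := by
    rw [Real.exp_lt_one_iff]
    norm_num
  have he0 := Real.exp_pos (-2)
  have h0 : 0 < gAux (Real.exp (-2)) := by
    have hl : 0 ≤ Real.log (Real.exp (-2) + 1) := Real.log_nonneg (by linarith)
    unfold gAux
    rw [Real.log_exp]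
    nlinarith
  have hsub : Set.Icc (Real.exp (-2)) 1 ⊆ Set.Ioc 0 1 := fun x hx => ⟨he0.trans_le hx.1, hx.2⟩
  obtain ⟨A, hA, hA0⟩ :=
    intermediate_value_Icc' he1.le (gAux_continuousOn.mono hsub) ⟨h1.le, h0.le⟩
  have hA' := hsub hA
  have hA1 : A < 1 := by
    refine lt_of_le_of_ne hA'.2 ?_
    rintro rfl
    linarith
  refine ⟨A, ⟨⟨hA'.1, hA1⟩, (gAux_iff hA'.1).2 hA0⟩, ?_⟩
  rintro B ⟨hB, hBe⟩
  exact gAux_strictAntiOn.injOn ⟨hB.1, hB.2.le⟩ hA' (((gAux_iff hB.1).1 hBe).trans hA0.symm)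
end
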